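/- arXiv:2311.16649 — 2 statements merged into one kernel-verified Lean document; each statement's English description precedes it below -/
import Mathlib

section
/- Let D ⊆ ℂ be an open set and let f : ℂ → ℂ be complex differentiable at every point of D. Let γ₀, γ₁ : [0,1] → ℂ be two continuously differentiable paths contained in D with the same initial point z₀ and the same final point z₁, which are homotopic within D relative to their endpoints. Then ∫_0^1 f(γ₀(t))·γ₀'(t) dt = ∫_0^1 f(γ₁(t))·γ₁'(t) dt. -/
open Set Metric

/-- The integral of `f` along the straight segment from `z` to `w`. -/
noncomputable def segmentIntegral (f : ℂ → ℂ) (z w : ℂ) : ℂ :=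
  ∫ t in (0:ℝ)..1, f (AffineMap.lineMap z w t) * (w - z)

@[simp]
theorem segmentIntegral_self (f : ℂ → ℂ) (z : ℂ) : segmentIntegral f z z = 0 := by
  simp [segmentIntegral]

/-- The integral along a path of a continuous function with a primitive `g` is the increment
of `g`. -/
theorem integral_comp_mul_deriv_of_primitive {γ γ' : ℝ → ℂ} {F G : ℂ → ℂ} {U : Set ℂ}
    {a b : ℝ} (hab : a ≤ b) (hF : ContinuousOn F U) (hG : ∀ z ∈ U, HasDerivAt G (F z) z)
    (hγ : ∀ t ∈ Icc a b, HasDerivAt γ (γ' t) t) (hγ' : ContinuousOn γ' (Icc a b))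
    (hU : MapsTo γ (Icc a b) U) :
    ∫ t in a..b, F (γ t) * γ' t = G (γ b) - G (γ a) := by
  rw [← uIcc_of_le hab] at hγ hγ' hU
  refine intervalIntegral.integral_eq_sub_of_hasDerivAt (f := fun t ↦ G (γ t))
    (fun t ht ↦ (hG _ (hU ht)).comp t (hγ t ht)) ?_
  exact ((hF.comp (HasDerivAt.continuousOn hγ) hU).mul hγ').intervalIntegrable

theorem segmentIntegral_eq_sub {f g : ℂ → ℂ} {U : Set ℂ} (hU : Convex ℝ U)
    (hf : ContinuousOn f U) (hg : ∀ z ∈ U, HasDerivAt g (f z) z) {z w : ℂ} (hz : z ∈ U)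
    (hw : w ∈ U) : segmentIntegral f z w = g w - g z := by
  have := integral_comp_mul_deriv_of_primitive (γ := fun t : ℝ ↦ AffineMap.lineMap z w t)
    (γ' := fun _ ↦ w - z) zero_le_one hf hg
    (fun t _ ↦ AffineMap.hasDerivAt_lineMap) continuousOn_const
    (fun t ht ↦ hU.lineMap_mem hz hw ht)
  simpa [segmentIntegral] using this

/-- Integrals of a holomorphic function along the two ways around a quadrilateral in a disc
agree. -/
theorem segmentIntegral_add_segmentIntegral_eq {f : ℂ → ℂ} {c : ℂ} {r : ℝ}
    (hf : DifferentiableOn ℂ f (ball c r)) {z₁ z₂ w₁ w₂ : ℂ} (hz₁ : z₁ ∈ ball c r)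
    (hz₂ : z₂ ∈ ball c r) (hw₁ : w₁ ∈ ball c r) (hw₂ : w₂ ∈ ball c r) :
    segmentIntegral f z₁ z₂ + segmentIntegral f z₂ w₂ =
      segmentIntegral f z₁ w₁ + segmentIntegral f w₁ w₂ := by
  obtain ⟨g, hg⟩ := hf.isExactOn_ball
  have key {z w : ℂ} (hz : z ∈ ball c r) (hw : w ∈ ball c r) :=
    segmentIntegral_eq_sub (convex_ball c r) hf.continuousOn hg hz hw
  rw [key hz₁ hz₂, key hz₂ hw₂, key hz₁ hw₁, key hw₁ hw₂]
  ring

/-- The integral of a holomorphic function along a path equals the integral along an inscribed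
polygonal line which is close enough to the path. -/
theorem integral_eq_sum_segmentIntegral {f : ℂ → ℂ} {γ γ' : ℝ → ℂ} {r : ℝ} {N : ℕ}
    (hN : 0 < N) (hγ : ∀ t ∈ Icc (0:ℝ) 1, HasDerivAt γ (γ' t) t)
    (hγ' : ContinuousOn γ' (Icc 0 1))
    (hf : ∀ t ∈ Icc (0:ℝ) 1, DifferentiableOn ℂ f (ball (γ t) r))
    (hclose : ∀ s ∈ Icc (0:ℝ) 1, ∀ t ∈ Icc (0:ℝ) 1, |s - t| ≤ 1 / N → γ s ∈ ball (γ t) r) :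
    ∫ t in (0:ℝ)..1, f (γ t) * γ' t =
      ∑ j ∈ Finset.range N, segmentIntegral f (γ (j / N)) (γ ((j + 1 : ℕ) / N)) := by
  have hN' : (0:ℝ) < N := by exact_mod_cast hN
  have hdiv {j : ℕ} (hj : j ≤ N) : (j / N : ℝ) ∈ Icc (0:ℝ) 1 :=
    ⟨by positivity, div_le_one_of_le₀ (by exact_mod_cast hj) hN'.le⟩
  have hfγ : ContinuousOn (fun t ↦ f (γ t) * γ' t) (Icc 0 1) := by
    refine ContinuousOn.mul (fun t ht ↦ ?_) hγ'
    have hr := hclose t ht t ht (by simp)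
    exact ContinuousAt.comp_continuousWithinAt (g := f)
      ((hf t ht).differentiableAt (isOpen_ball.mem_nhds hr)).continuousAt
      (hγ t ht).continuousAt.continuousWithinAt
  have hsum := intervalIntegral.sum_integral_adjacent_intervals (μ := MeasureTheory.volume)
    (f := fun t ↦ f (γ t) * γ' t) (a := fun j : ℕ ↦ (j / N : ℝ)) (n := N)
    (fun j hj ↦ (hfγ.mono
      (uIcc_subset_Icc (hdiv hj.le) (hdiv hj))).intervalIntegrable)
  simp only [Nat.cast_zero, zero_div, div_self hN'.ne'] at hsum
  rw [← hsum]
  refine Finset.sum_congr rfl fun j hj ↦ ?_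
  rw [Finset.mem_range] at hj
  have hstep : ((j + 1 : ℕ) / N : ℝ) = j / N + 1 / N := by push_cast; ring
  have hle : (j / N : ℝ) ≤ (j + 1 : ℕ) / N := by rw [hstep]; simp
  have hsub : Icc (j / N : ℝ) ((j + 1 : ℕ) / N) ⊆ Icc 0 1 :=
    Icc_subset_Icc (hdiv hj.le).1 (hdiv hj).2
  have hmaps : MapsTo γ (Icc (j / N : ℝ) ((j + 1 : ℕ) / N)) (ball (γ (j / N)) r) := by
    intro t ht
    refine hclose t (hsub ht) _ (hdiv hj.le) ?_
    rw [abs_of_nonneg (sub_nonneg.2 ht.1)]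
    linarith [ht.2]
  have hfj := hf _ (hdiv hj.le)
  obtain ⟨g, hg⟩ := hfj.isExactOn_ball
  rw [segmentIntegral_eq_sub (convex_ball _ _) hfj.continuousOn hg (hmaps ⟨le_rfl, hle⟩)
    (hmaps ⟨hle, le_rfl⟩)]
  exact integral_comp_mul_deriv_of_primitive hle hfj.continuousOn hg
    (fun t ht ↦ hγ t (hsub ht)) (hγ'.mono hsub) hmaps

/-- If the increments along the boundary of each cell of an `M × N` grid cancel, and the
increments along the two lateral sides vanish, then the sums along the first and the last row
agree. -/
theorem sum_range_eq_of_grid {A : Type*} [AddCommGroup A] {M N : ℕ} (h v : ℕ → ℕ → A)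
    (hcell : ∀ i < M, ∀ j < N, h i j + v i (j + 1) = v i j + h (i + 1) j)
    (hleft : ∀ i < M, v i 0 = 0) (hright : ∀ i < M, v i N = 0) :
    ∑ j ∈ Finset.range N, h 0 j = ∑ j ∈ Finset.range N, h M j := by
  suffices ∀ i ≤ M, ∑ j ∈ Finset.range N, h 0 j = ∑ j ∈ Finset.range N, h i j from this M le_rfl
  intro i hi
  induction i with
  | zero => rfl
  | succ i ih =>
    rw [ih (by omega), ← sub_eq_zero, ← Finset.sum_sub_distrib]
    calc ∑ j ∈ Finset.range N, (h i j - h (i + 1) j)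
        = ∑ j ∈ Finset.range N, (v i j - v i (j + 1)) := Finset.sum_congr rfl fun j hj ↦ by
          rw [sub_eq_sub_iff_add_eq_add, hcell i (by omega) j (Finset.mem_range.1 hj)]
      _ = 0 := by rw [Finset.sum_range_sub', hleft i (by omega), hright i (by omega), sub_zero]


/-- (Homotopy invariance of the complex integral) If `f` is complex differentiable on an
open set `D` and `γ₀, γ₁` are continuously differentiable paths in `D` with the same
endpoints which are homotopic within `D` relative to their endpoints, then
`∫_0^1 f(γ₀(t)) γ₀'(t) dt = ∫_0^1 f(γ₁(t)) γ₁'(t) dt`. -/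
theorem cauchy_homotopy_invariance (D : Set ℂ) (hD : IsOpen D) (f : ℂ → ℂ)
    (hf : ∀ z ∈ D, DifferentiableAt ℂ f z)
    (z₀ z₁ : ℂ) (γ₀ γ₁ γ₀' γ₁' : ℝ → ℂ)
    (hγ₀ : ∀ t ∈ Set.Icc (0:ℝ) 1, HasDerivAt γ₀ (γ₀' t) t)
    (hγ₀' : ContinuousOn γ₀' (Set.Icc 0 1))
    (hγ₁ : ∀ t ∈ Set.Icc (0:ℝ) 1, HasDerivAt γ₁ (γ₁' t) t)
    (hγ₁' : ContinuousOn γ₁' (Set.Icc 0 1))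
    (hγ₀D : ∀ t ∈ Set.Icc (0:ℝ) 1, γ₀ t ∈ D)
    (hγ₁D : ∀ t ∈ Set.Icc (0:ℝ) 1, γ₁ t ∈ D)
    (h00 : γ₀ 0 = z₀) (h01 : γ₀ 1 = z₁) (h10 : γ₁ 0 = z₀) (h11 : γ₁ 1 = z₁)
    (H : ℝ × ℝ → ℂ)
    (hH : ContinuousOn H (Set.Icc 0 1 ×ˢ Set.Icc 0 1))
    (hHD : ∀ p ∈ Set.Icc (0:ℝ) 1 ×ˢ Set.Icc (0:ℝ) 1, H p ∈ D)
    (hH0 : ∀ t ∈ Set.Icc (0:ℝ) 1, H (0, t) = γ₀ t)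
    (hH1 : ∀ t ∈ Set.Icc (0:ℝ) 1, H (1, t) = γ₁ t)
    (hHa : ∀ s ∈ Set.Icc (0:ℝ) 1, H (s, 0) = z₀)
    (hHb : ∀ s ∈ Set.Icc (0:ℝ) 1, H (s, 1) = z₁) :
    ∫ t in (0:ℝ)..1, f (γ₀ t) * γ₀' t = ∫ t in (0:ℝ)..1, f (γ₁ t) * γ₁' t := by
  have hK : IsCompact (Icc (0:ℝ) 1 ×ˢ Icc (0:ℝ) 1) := isCompact_Icc.prod isCompact_Icc
  obtain ⟨r, hr, hrD⟩ := (hK.image_of_continuousOn hH).exists_thickening_subset_open hD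
    (image_subset_iff.2 hHD)
  have hfr (p) (hp : p ∈ Icc (0:ℝ) 1 ×ˢ Icc (0:ℝ) 1) : DifferentiableOn ℂ f (ball (H p) r) :=
    fun z hz ↦ (hf z <| hrD <|
      ball_subset_thickening (mem_image_of_mem H hp) r hz).differentiableWithinAt
  obtain ⟨δ, hδ, hHδ⟩ := Metric.uniformContinuousOn_iff.1
    (hK.uniformContinuousOn_of_continuous hH) r hr
  obtain ⟨n, hn⟩ := exists_nat_one_div_lt hδ
  obtain ⟨N, hN, hNδ⟩ : ∃ N : ℕ, 0 < N ∧ (1 / N : ℝ) < δ :=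
    ⟨n + 1, n.succ_pos, by exact_mod_cast hn⟩
  have hN' : (0:ℝ) < N := by exact_mod_cast hN
  have hdiv {j : ℕ} (hj : j ≤ N) : (j / N : ℝ) ∈ Icc (0:ℝ) 1 :=
    ⟨by positivity, div_le_one_of_le₀ (by exact_mod_cast hj) hN'.le⟩
  have hstep (j : ℕ) : |((j + 1 : ℕ) / N : ℝ) - j / N| ≤ 1 / N := by
    rw [show ((j + 1 : ℕ) / N : ℝ) - j / N = 1 / N by push_cast; ring, abs_of_pos (by positivity)]
  have hclose {s t s' t' : ℝ} (hs : s ∈ Icc (0:ℝ) 1) (ht : t ∈ Icc (0:ℝ) 1)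
      (hs' : s' ∈ Icc (0:ℝ) 1) (ht' : t' ∈ Icc (0:ℝ) 1) (hss' : |s - s'| ≤ 1 / N)
      (htt' : |t - t'| ≤ 1 / N) : H (s, t) ∈ ball (H (s', t')) r :=
    hHδ _ ⟨hs, ht⟩ _ ⟨hs', ht'⟩ ((max_le hss' htt').trans_lt hNδ)
  have hpath {s : ℝ} (hs : s ∈ Icc (0:ℝ) 1) {γ γ' : ℝ → ℂ}
      (hγ : ∀ t ∈ Icc (0:ℝ) 1, HasDerivAt γ (γ' t) t) (hγ' : ContinuousOn γ' (Icc 0 1))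
      (hHγ : ∀ t ∈ Icc (0:ℝ) 1, H (s, t) = γ t) :
      ∫ t in (0:ℝ)..1, f (γ t) * γ' t =
        ∑ j ∈ Finset.range N, segmentIntegral f (H (s, j / N)) (H (s, (j + 1 : ℕ) / N)) := by
    rw [integral_eq_sum_segmentIntegral hN hγ hγ' (r := r)
      (fun t ht ↦ hHγ t ht ▸ hfr _ ⟨hs, ht⟩) fun t ht t' ht' htt' ↦ by
        rw [← hHγ t ht, ← hHγ t' ht']
        exact hclose hs ht hs ht' (by simp) htt']
    refine Finset.sum_congr rfl fun j hj ↦ ?_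
    rw [Finset.mem_range] at hj
    rw [hHγ _ (hdiv hj.le), hHγ _ (hdiv hj)]
  rw [hpath ⟨le_rfl, zero_le_one⟩ hγ₀ hγ₀' hH0, hpath ⟨zero_le_one, le_rfl⟩ hγ₁ hγ₁' hH1]
  have hgrid := sum_range_eq_of_grid (M := N) (N := N)
    (fun i j ↦ segmentIntegral f (H (i / N, j / N)) (H (i / N, (j + 1 : ℕ) / N)))
    (fun i j ↦ segmentIntegral f (H (i / N, j / N)) (H ((i + 1 : ℕ) / N, j / N))) ?_ ?_ ?_
  · simpa only [Nat.cast_zero, zero_div, div_self hN'.ne'] using hgrid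
  · intro i hi j hj
    have hii : |(i / N : ℝ) - i / N| ≤ 1 / N := by simp
    have hjj : |(j / N : ℝ) - j / N| ≤ 1 / N := by simp
    exact segmentIntegral_add_segmentIntegral_eq (hfr _ ⟨hdiv hi.le, hdiv hj.le⟩)
      (mem_ball_self hr)
      (hclose (hdiv hi.le) (hdiv hj) (hdiv hi.le) (hdiv hj.le) hii (hstep j))
      (hclose (hdiv hi) (hdiv hj.le) (hdiv hi.le) (hdiv hj.le) (hstep i) hjj)
      (hclose (hdiv hi) (hdiv hj) (hdiv hi.le) (hdiv hj.le) (hstep i) (hstep j))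
  · intro i hi
    simp only [Nat.cast_zero, zero_div, hHa _ (hdiv hi.le), hHa _ (hdiv hi), segmentIntegral_self]
  · intro i hi
    simp only [div_self hN'.ne', hHb _ (hdiv hi.le), hHb _ (hdiv hi), segmentIntegral_self]
end

section
/- (Riemann's proof of the divergence formula in the plane) Let a ≤ b and let x₁, x₂ : [a,b] → ℝ be continuous functions with x₁(y) ≤ x₂(y) for all y ∈ [a,b]. Let T = {(x,y) : a ≤ y ≤ b, x₁(y) ≤ x ≤ x₂(y)} and let X : ℝ × ℝ → ℝ be continuously differentiable on an open set containing T. Then ∫∫_T ∂X/∂x dx dy = ∫_a^b ( X(x₂(y), y) - X(x₁(y), y) ) dy. -/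
open MeasureTheory Set

/-- The closed region between the graphs of two continuous functions on a compact interval,
with the parameter in the second coordinate, is compact. -/
theorem isCompact_setOf_mem_Icc_graphs {a b : ℝ} {f g : ℝ → ℝ}
    (hf : ContinuousOn f (Icc a b)) (hg : ContinuousOn g (Icc a b)) :
    IsCompact {p : ℝ × ℝ | p.2 ∈ Icc a b ∧ p.1 ∈ Icc (f p.2) (g p.2)} := by
  have hclosed : IsClosed {p : ℝ × ℝ | p.2 ∈ Icc a b ∧ p.1 ∈ Icc (f p.2) (g p.2)} := by
    have hS : IsClosed {p : ℝ × ℝ | p.2 ∈ Icc a b} := isClosed_Icc.preimage continuous_snd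
    have hf' : ContinuousOn (fun p : ℝ × ℝ => f p.2) {p : ℝ × ℝ | p.2 ∈ Icc a b} :=
      hf.comp continuousOn_snd fun _ hp => hp
    have hg' : ContinuousOn (fun p : ℝ × ℝ => g p.2) {p : ℝ × ℝ | p.2 ∈ Icc a b} :=
      hg.comp continuousOn_snd fun _ hp => hp
    convert (hS.isClosed_le hf' continuousOn_fst).inter (hS.isClosed_le continuousOn_fst hg')
      using 1
    ext p
    simp only [mem_ofPred_eq, mem_inter_iff, mem_Icc]
    tauto
  obtain ⟨m, hm⟩ := (isCompact_Icc.image_of_continuousOn hf).bddBelow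
  obtain ⟨M, hM⟩ := (isCompact_Icc.image_of_continuousOn hg).bddAbove
  refine (isCompact_Icc.prod isCompact_Icc : IsCompact (Icc m M ×ˢ Icc a b)).of_isClosed_subset
    hclosed ?_
  rintro p ⟨hy, hx⟩
  exact ⟨⟨(hm (mem_image_of_mem f hy)).trans hx.1, hx.2.trans (hM (mem_image_of_mem g hy))⟩, hy⟩

/-- The fundamental theorem of calculus along a horizontal segment. -/
theorem integral_fderiv_horizontal {X : ℝ × ℝ → ℝ} {U : Set (ℝ × ℝ)} (hU : IsOpen U)
    (hX : ContDiffOn ℝ 1 X U) {c d y : ℝ} (hcd : c ≤ d) (hsub : ∀ x ∈ Icc c d, (x, y) ∈ U) :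
    ∫ x in c..d, fderiv ℝ X (x, y) (1, 0) = X (d, y) - X (c, y) := by
  rw [← uIcc_of_le hcd] at hsub
  refine intervalIntegral.integral_eq_sub_of_hasDerivAt (f := fun x => X (x, y)) ?_ ?_
  · intro x hx
    have hd : HasFDerivAt X (fderiv ℝ X (x, y)) (x, y) :=
      ((hX.differentiableOn one_ne_zero).differentiableAt
        (hU.mem_nhds (hsub x hx))).hasFDerivAt
    exact hd.comp_hasDerivAt x ((hasDerivAt_id x).prodMk (hasDerivAt_const x y))
  · have hc : ContinuousOn (fun x => fderiv ℝ X (x, y)) (uIcc c d) :=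
      (hX.continuousOn_fderiv_of_isOpen hU le_rfl).comp (by fun_prop) hsub
    exact (hc.clm_apply continuousOn_const).intervalIntegrable

/-- (Riemann's proof of the divergence formula in the plane) For the region `T` between
the graphs `x = x₁(y)` and `x = x₂(y)`, `a ≤ y ≤ b`, and `X` continuously differentiable
on an open set containing `T`,
`∫∫_T ∂X/∂x = ∫_a^b (X(x₂(y), y) - X(x₁(y), y)) dy`. -/
theorem riemann_divergence_plane (a b : ℝ) (hab : a ≤ b) (x₁ x₂ : ℝ → ℝ)
    (hx₁ : ContinuousOn x₁ (Set.Icc a b)) (hx₂ : ContinuousOn x₂ (Set.Icc a b))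
    (hle : ∀ y ∈ Set.Icc a b, x₁ y ≤ x₂ y)
    (X : ℝ × ℝ → ℝ) (U : Set (ℝ × ℝ)) (hU : IsOpen U)
    (hTU : {p : ℝ × ℝ | p.2 ∈ Set.Icc a b ∧ p.1 ∈ Set.Icc (x₁ p.2) (x₂ p.2)} ⊆ U)
    (hX : ContDiffOn ℝ 1 X U) :
    ∫ p in {p : ℝ × ℝ | p.2 ∈ Set.Icc a b ∧ p.1 ∈ Set.Icc (x₁ p.2) (x₂ p.2)},
        fderiv ℝ X p (1, 0) =
      ∫ y in a..b, (X (x₂ y, y) - X (x₁ y, y)) := by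
  set T := {p : ℝ × ℝ | p.2 ∈ Set.Icc a b ∧ p.1 ∈ Set.Icc (x₁ p.2) (x₂ p.2)} with hT
  have hTc : IsCompact T := isCompact_setOf_mem_Icc_graphs hx₁ hx₂
  have hint : IntegrableOn (fun p => fderiv ℝ X p (1, 0)) T :=
    (((hX.continuousOn_fderiv_of_isOpen hU le_rfl).mono hTU).clm_apply
      continuousOn_const).integrableOn_compact hTc
  rw [← integral_indicator hTc.measurableSet, Measure.volume_eq_prod,
    integral_prod_symm _ ((integrable_indicator_iff hTc.measurableSet).2 hint),
    intervalIntegral.integral_of_le hab, ← integral_Icc_eq_integral_Ioc,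
    ← integral_indicator measurableSet_Icc]
  congr 1
  ext y
  by_cases hy : y ∈ Icc a b
  · have hslice : (fun x => T.indicator (fun p => fderiv ℝ X p (1, 0)) (x, y)) =
        (Icc (x₁ y) (x₂ y)).indicator fun x => fderiv ℝ X (x, y) (1, 0) := by
      ext x
      simp only [indicator_apply, hT, mem_ofPred_eq, hy, true_and]
    rw [hslice, indicator_of_mem hy, integral_indicator measurableSet_Icc,
      integral_Icc_eq_integral_Ioc, ← intervalIntegral.integral_of_le (hle y hy)]
    exact integral_fderiv_horizontal hU hX (hle y hy) fun x hx => hTU ⟨hy, hx⟩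
  · have hslice : ∀ x, (x, y) ∉ T := fun x hx => hy hx.1
    simp [hslice, hy]
end
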